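/- arXiv:1804.00567 — 3 statements merged into one kernel-verified Lean document; each statement's English description precedes it below -/
import Mathlib

section
/- (Gaussian version of Janson's second moment method, contiguity and likelihood-ratio limit.) Let P_n and Q_n be sequences of probability measures on common measurable spaces (Ω_n, F_n), and for each i ≥ 1 let W_{n,i} be random variables on (Ω_n, F_n). Suppose: (i) Q_n ≪ P_n for each n; (ii) for every fixed k ≥ 1, (W_{n,1},…,W_{n,k}) converges in distribution under P_n to (Z₁,…,Z_k) and under Q_n to (Z'₁,…,Z'_k); (iii) the Z_i are independent with Z_i ~ N(0, σ_i²) and the Z'_i are independent with Z'_i ~ N(μ_i, σ_i²); (iv) the likelihood ratio Y_n = dQ_n/dP_n satisfies limsup_n E_{P_n}[Y_n²] ≤ exp{Σ_{i=1}^∞ μ_i²/σ_i²} < ∞. Then P_n and Q_n are asymptotically mutually contiguous, and under P_n, Y_n converges in distribution to exp{Σ_{i=1}^∞ (μ_i Z_i − ½μ_i²)/σ_i²}. -/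
/- Statement 7: Gaussian version of Janson's second moment method:
mutual contiguity and the limit of the likelihood ratio. -/

open MeasureTheory ProbabilityTheory Filter Topology

noncomputable section

/-- Convergence in distribution: the laws of `f n` under `P n` converge weakly
to `μ`, i.e. integrals of every bounded continuous function converge. -/
def TendstoInDist {Ω : ℕ → Type*} [∀ n, MeasurableSpace (Ω n)] {E : Type*}
    [TopologicalSpace E] [MeasurableSpace E] (P : ∀ n, Measure (Ω n))
    (f : ∀ n, Ω n → E) (μ : Measure E) : Prop :=
  ∀ g : BoundedContinuousFunction E ℝ,
    Tendsto (fun n => ∫ x, g (f n x) ∂P n) atTop (𝓝 (∫ y, g y ∂μ))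

namespace JansonSecondMoment

lemma map_sum_pi_gaussianReal {ι : Type*} [Fintype ι] (m : ι → ℝ) (s : ι → NNReal) :
    (Measure.pi fun i => gaussianReal (m i) (s i)).map (fun x => ∑ i, x i) =
      gaussianReal (∑ i, m i) (∑ i, s i) := by
  refine Measure.ext_of_charFun ?_
  ext t
  rw [charFun_gaussianReal, charFun_apply_real, integral_map (by fun_prop) (by fun_prop)]
  have h : ∀ x : ι → ℝ, Complex.exp (t * ((∑ i, x i : ℝ) : ℂ) * Complex.I) =
      ∏ i, Complex.exp (t * x i * Complex.I) := by
    intro x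
    rw [← Complex.exp_sum]
    push_cast
    rw [Finset.mul_sum, Finset.sum_mul]
  simp_rw [h]
  rw [integral_fintype_prod_eq_prod (fun i (y : ℝ) => Complex.exp (t * y * Complex.I))]
  simp_rw [← charFun_apply_real, charFun_gaussianReal]
  rw [← Complex.exp_sum]
  push_cast
  rw [Finset.sum_sub_distrib, Finset.mul_sum, Finset.sum_mul, Finset.sum_mul, Finset.sum_div]

/-- The logarithm of the density of `⨂ N(μ i, v i)` with respect to `⨂ N(0, v i)`. -/
def logLR {ι : Type*} [Fintype ι] (μ v : ι → ℝ) (x : ι → ℝ) : ℝ :=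
  ∑ i, (μ i / v i * x i - μ i ^ 2 / v i / 2)

@[fun_prop]
lemma continuous_logLR {ι : Type*} [Fintype ι] (μ v : ι → ℝ) : Continuous (logLR μ v) := by
  unfold logLR
  fun_prop

lemma map_logLR {ι : Type*} [Fintype ι] (μ v m : ι → ℝ) (hv : ∀ i, 0 < v i) :
    (Measure.pi fun i => gaussianReal (m i) (v i).toNNReal).map (logLR μ v) =
      gaussianReal (∑ i, (μ i / v i * m i - μ i ^ 2 / v i / 2))
        (∑ i, μ i ^ 2 / v i).toNNReal := by
  have h1 : logLR μ v = (fun x : ι → ℝ => ∑ i, x i) ∘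
      (fun x i => μ i / v i * x i - μ i ^ 2 / v i / 2) := rfl
  have h2 : ∀ i, (gaussianReal (m i) (v i).toNNReal).map
      (fun y => μ i / v i * y - μ i ^ 2 / v i / 2) =
      gaussianReal (μ i / v i * m i - μ i ^ 2 / v i / 2) (μ i ^ 2 / v i).toNNReal := by
    intro i
    have := gaussianReal_map_const_mul (μ := m i) (v := (v i).toNNReal) (μ i / v i)
    have h3 := gaussianReal_map_sub_const
      (μ := μ i / v i * m i) (v := NNReal.mk ((μ i / v i) ^ 2) (sq_nonneg _) * (v i).toNNReal)
      (μ i ^ 2 / v i / 2)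
    rw [← this, Measure.map_map (by fun_prop) (by fun_prop)] at h3
    have h4 : (NNReal.mk ((μ i / v i) ^ 2) (sq_nonneg _) * (v i).toNNReal : NNReal) =
        (μ i ^ 2 / v i).toNNReal := by
      have := hv i
      ext
      rw [NNReal.coe_mul, Real.coe_toNNReal _ this.le, Real.coe_toNNReal _ (by positivity)]
      simp only [NNReal.coe_mk]
      field_simp
    rw [← h4]
    exact h3
  rw [h1, ← Measure.map_map (by fun_prop) (by fun_prop),
    Measure.pi_map_pi (f := fun i y => μ i / v i * y - μ i ^ 2 / v i / 2) (by fun_prop)]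
  simp_rw [h2]
  rw [map_sum_pi_gaussianReal, Real.toNNReal_sum_of_nonneg]
  intro i _
  have := hv i
  positivity

lemma integral_exp_mul_gaussianReal (m t : ℝ) (s : NNReal) :
    ∫ x, Real.exp (t * x) ∂gaussianReal m s = Real.exp (m * t + s * t ^ 2 / 2) := by
  have := congrFun (mgf_id_gaussianReal (μ := m) (v := s)) t
  simpa [mgf] using this

/-- The function `x ↦ min (exp x) M`, truncated exponential. -/
def truncExp (M : ℕ) (x : ℝ) : ℝ := min (Real.exp x) M

@[fun_prop]
lemma continuous_truncExp (M : ℕ) : Continuous (truncExp M) := by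
  unfold truncExp
  fun_prop

lemma truncExp_nonneg (M : ℕ) (x : ℝ) : 0 ≤ truncExp M x :=
  le_min (Real.exp_pos x).le M.cast_nonneg

lemma truncExp_le_exp (M : ℕ) (x : ℝ) : truncExp M x ≤ Real.exp x := min_le_left _ _

lemma tendsto_truncExp (x : ℝ) : Tendsto (fun M => truncExp M x) atTop (𝓝 (Real.exp x)) := by
  refine tendsto_const_nhds.congr' ?_
  filter_upwards [eventually_ge_atTop ⌈Real.exp x⌉₊] with M hM
  exact (min_eq_left ((Nat.le_ceil _).trans (by exact_mod_cast hM))).symm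

lemma tendsto_integral_truncExp (m : ℝ) (s : NNReal) :
    Tendsto (fun M => ∫ x, truncExp M x ∂gaussianReal m s) atTop
      (𝓝 (Real.exp (m + s / 2))) := by
  have h := integral_exp_mul_gaussianReal m 1 s
  simp only [one_mul, mul_one, one_pow] at h
  rw [← h]
  refine tendsto_integral_of_dominated_convergence Real.exp (fun M => by fun_prop) ?_ ?_ ?_
  · simpa using integrable_exp_mul_gaussianReal (μ := m) (v := s) 1
  · intro M
    filter_upwards with x
    rw [Real.norm_of_nonneg (truncExp_nonneg M x)]
    exact truncExp_le_exp M x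
  · filter_upwards with x using tendsto_truncExp x

lemma tendsto_integral_truncExp_sq (m : ℝ) (s : NNReal) :
    Tendsto (fun M => ∫ x, truncExp M x ^ 2 ∂gaussianReal m s) atTop
      (𝓝 (Real.exp (2 * m + 2 * s))) := by
  have h := integral_exp_mul_gaussianReal m 2 s
  rw [show 2 * m + 2 * (s : ℝ) = m * 2 + s * 2 ^ 2 / 2 by ring, ← h]
  refine tendsto_integral_of_dominated_convergence (fun x => Real.exp (2 * x))
    (fun M => by fun_prop) ?_ ?_ ?_
  · exact integrable_exp_mul_gaussianReal (μ := m) (v := s) 2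
  · intro M
    filter_upwards with x
    rw [Real.norm_of_nonneg (by positivity), two_mul, Real.exp_add, ← sq]
    have := truncExp_nonneg M x
    have := truncExp_le_exp M x
    gcongr
  · filter_upwards with x
    rw [two_mul, Real.exp_add, ← sq]
    exact (tendsto_truncExp x).pow 2

lemma tendsto_integral_comp_truncExp (g : BoundedContinuousFunction ℝ ℝ) (m : ℝ) (s : NNReal) :
    Tendsto (fun M => ∫ x, g (truncExp M x) ∂gaussianReal m s) atTop
      (𝓝 (∫ x, g (Real.exp x) ∂gaussianReal m s)) := by
  refine tendsto_integral_of_dominated_convergence (fun _ => ‖g‖)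
    (fun M => by fun_prop) (integrable_const _) ?_ ?_
  · intro M
    filter_upwards with x using g.norm_coe_le_norm _
  · filter_upwards with x
    exact (g.continuous.tendsto _).comp (tendsto_truncExp x)

lemma gaussianReal_eq_map_standard (m s : ℝ) (hs : 0 ≤ s) :
    gaussianReal m s.toNNReal = (gaussianReal 0 1).map (fun x => √s * x + m) := by
  have h1 := gaussianReal_map_const_mul (μ := 0) (v := 1) (√s)
  have h2 := gaussianReal_map_add_const (μ := √s * 0)
    (v := NNReal.mk ((√s) ^ 2) (sq_nonneg _) * 1) m
  rw [← h1, Measure.map_map (by fun_prop) (by fun_prop)] at h2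
  have h4 : (NNReal.mk ((√s) ^ 2) (sq_nonneg _) * 1 : NNReal) = s.toNNReal := by
    ext
    simp [Real.sq_sqrt hs, hs]
  rw [h4, mul_zero, zero_add] at h2
  exact h2.symm

lemma tendsto_integral_gaussianReal (g : BoundedContinuousFunction ℝ ℝ) {m s : ℕ → ℝ}
    {m₀ s₀ : ℝ} (hs : ∀ n, 0 ≤ s n) (hm₀ : Tendsto m atTop (𝓝 m₀))
    (hs₀ : Tendsto s atTop (𝓝 s₀)) :
    Tendsto (fun n => ∫ x, g x ∂gaussianReal (m n) (s n).toNNReal) atTop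
      (𝓝 (∫ x, g x ∂gaussianReal m₀ s₀.toNNReal)) := by
  have h0 : 0 ≤ s₀ := ge_of_tendsto' hs₀ hs
  rw [gaussianReal_eq_map_standard m₀ s₀ h0, integral_map (by fun_prop) (by fun_prop)]
  have : ∀ n, ∫ x, g x ∂gaussianReal (m n) (s n).toNNReal =
      ∫ x, g (√(s n) * x + m n) ∂gaussianReal 0 1 := by
    intro n
    rw [gaussianReal_eq_map_standard _ _ (hs n), integral_map (by fun_prop) (by fun_prop)]
  simp_rw [this]
  refine tendsto_integral_of_dominated_convergence (fun _ => ‖g‖)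
    (fun M => by fun_prop) (integrable_const _) ?_ ?_
  · intro M
    filter_upwards with x using g.norm_coe_le_norm _
  · filter_upwards with x
    refine (g.continuous.tendsto _).comp ?_
    exact ((Real.continuous_sqrt.tendsto _ |>.comp hs₀).mul_const x).add hm₀

lemma TendstoInDist.eventually_aestronglyMeasurable {Ω : ℕ → Type*}
    [∀ n, MeasurableSpace (Ω n)] {E : Type*} [TopologicalSpace E] [MeasurableSpace E]
    [OpensMeasurableSpace E] {P : ∀ n, Measure (Ω n)} {f : ∀ n, Ω n → E} {N : Measure E}
    [IsProbabilityMeasure N] (hf : TendstoInDist P f N) (h : BoundedContinuousFunction E ℝ) :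
    ∀ᶠ n in atTop, AEStronglyMeasurable (fun ω => h (f n ω)) (P n) := by
  have key := hf (h + BoundedContinuousFunction.const E (‖h‖ + 1))
  have hpos : 0 < ∫ y, (h + BoundedContinuousFunction.const E (‖h‖ + 1)) y ∂N := by
    have h1 : ∫ _, (1 : ℝ) ∂N ≤ ∫ y, (h + BoundedContinuousFunction.const E (‖h‖ + 1)) y ∂N := by
      refine integral_mono (integrable_const _) (BoundedContinuousFunction.integrable _ _) ?_
      intro y
      have := neg_le_of_abs_le (h.norm_coe_le_norm y)
      simp only [BoundedContinuousFunction.coe_add, Pi.add_apply,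
        BoundedContinuousFunction.const_apply]
      linarith
    simp only [integral_const, probReal_univ, smul_eq_mul, mul_one] at h1
    linarith
  filter_upwards [key.eventually_ne hpos.ne'] with n hn
  have hi := (Integrable.of_integral_ne_zero hn).aestronglyMeasurable
  have := hi.sub (aestronglyMeasurable_const (b := ‖h‖ + 1))
  refine this.congr (ae_of_all _ fun ω => ?_)
  simp

/-- If the limiting second moment of `dQ_n/dP_n` is at most `C`, then the squared `L²(P_n)`
distance between `dQ_n/dP_n` and a bounded continuous statistic `h (f n)` is asymptotically at
most `C - 2 𝔼[h(Z')] + 𝔼[h(Z)²]`. -/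
lemma eventually_integral_rnDeriv_sub_sq_lt {Ω : ℕ → Type*} [∀ n, MeasurableSpace (Ω n)]
    {E : Type*} [TopologicalSpace E] [MeasurableSpace E] [OpensMeasurableSpace E]
    {P Q : ∀ n, Measure (Ω n)} [∀ n, IsProbabilityMeasure (P n)]
    [∀ n, IsProbabilityMeasure (Q n)] (habs : ∀ n, Q n ≪ P n) {f : ∀ n, Ω n → E}
    {N N' : Measure E} [IsProbabilityMeasure N]
    (hP : TendstoInDist P f N) (hQ : TendstoInDist Q f N')
    {C ε : ℝ}
    (hY : ∀ C' > C, ∀ᶠ n in atTop, MemLp (fun ω => ((Q n).rnDeriv (P n) ω).toReal) 2 (P n) ∧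
      ∫ ω, ((Q n).rnDeriv (P n) ω).toReal ^ 2 ∂P n < C')
    (h : BoundedContinuousFunction E ℝ) (hε : C - 2 * ∫ y, h y ∂N' + ∫ y, h y ^ 2 ∂N < ε) :
    ∀ᶠ n in atTop, MemLp (fun ω => ((Q n).rnDeriv (P n) ω).toReal - h (f n ω)) 2 (P n) ∧
      ∫ ω, (((Q n).rnDeriv (P n) ω).toReal - h (f n ω)) ^ 2 ∂P n < ε := by
  obtain ⟨C', hC', hlt⟩ : ∃ C' > C, C' - 2 * ∫ y, h y ∂N' + ∫ y, h y ^ 2 ∂N < ε :=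
    ⟨C + (ε - (C - 2 * ∫ y, h y ∂N' + ∫ y, h y ^ 2 ∂N)) / 2, by linarith, by linarith⟩
  have h2 : Tendsto (fun n => ∫ x, h (f n x) ^ 2 ∂P n) atTop (𝓝 (∫ y, h y ^ 2 ∂N)) := by
    simpa [sq] using hP (h * h)
  have hlim : Tendsto (fun n => C' - 2 * ∫ x, h (f n x) ∂Q n + ∫ x, h (f n x) ^ 2 ∂P n) atTop
      (𝓝 (C' - 2 * ∫ y, h y ∂N' + ∫ y, h y ^ 2 ∂N)) :=
    (tendsto_const_nhds.sub ((hQ h).const_mul 2)).add h2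
  filter_upwards [hlim.eventually_lt_const hlt, hY C' hC',
    TendstoInDist.eventually_aestronglyMeasurable hP h] with n hn ⟨hL, hC⟩ hm
  have hh : MemLp (fun ω => h (f n ω)) 2 (P n) :=
    MemLp.of_bound hm ‖h‖ (ae_of_all _ fun ω => h.norm_coe_le_norm _)
  refine ⟨hL.sub hh, ?_⟩
  have e : ∫ ω, ((Q n).rnDeriv (P n) ω).toReal * h (f n ω) ∂P n = ∫ ω, h (f n ω) ∂Q n := by
    simpa using integral_rnDeriv_smul (habs n) (f := fun ω => h (f n ω))
  have hi : Integrable (fun ω => ((Q n).rnDeriv (P n) ω).toReal * h (f n ω)) (P n) :=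
    hL.integrable_mul hh
  have expand : ∫ ω, (((Q n).rnDeriv (P n) ω).toReal - h (f n ω)) ^ 2 ∂P n =
      ∫ ω, ((Q n).rnDeriv (P n) ω).toReal ^ 2 ∂P n - 2 * ∫ ω, h (f n ω) ∂Q n
        + ∫ ω, h (f n ω) ^ 2 ∂P n := by
    have hs : Integrable (fun ω => ((Q n).rnDeriv (P n) ω).toReal ^ 2 -
        2 * (((Q n).rnDeriv (P n) ω).toReal * h (f n ω))) (P n) :=
      hL.integrable_sq.sub (hi.const_mul 2)
    rw [← e, ← integral_const_mul, ← integral_sub hL.integrable_sq (hi.const_mul 2),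
      ← integral_add hs hh.integrable_sq]
    congr 1 with ω
    ring
  rw [expand]
  linarith

lemma eventually_memLp_rnDeriv {Ω : ℕ → Type*} [∀ n, MeasurableSpace (Ω n)]
    {P Q : ∀ n, Measure (Ω n)} [∀ n, IsProbabilityMeasure (P n)]
    [∀ n, IsProbabilityMeasure (Q n)] {C : ℝ} (hC : 0 ≤ C)
    (hsecond : limsup (fun n => ∫⁻ ω, ((Q n).rnDeriv (P n) ω) ^ 2 ∂P n) atTop ≤
      ENNReal.ofReal C) {C' : ℝ} (hC' : C < C') :
    ∀ᶠ n in atTop, MemLp (fun ω => ((Q n).rnDeriv (P n) ω).toReal) 2 (P n) ∧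
      ∫ ω, ((Q n).rnDeriv (P n) ω).toReal ^ 2 ∂P n < C' := by
  have hlt : limsup (fun n => ∫⁻ ω, ((Q n).rnDeriv (P n) ω) ^ 2 ∂P n) atTop <
      ENNReal.ofReal C' :=
    hsecond.trans_lt ((ENNReal.ofReal_lt_ofReal_iff (hC.trans_lt hC')).2 hC')
  filter_upwards [eventually_lt_of_limsup_lt hlt] with n hn
  have hm : Measurable fun ω => ((Q n).rnDeriv (P n) ω).toReal :=
    (Measure.measurable_rnDeriv _ _).ennreal_toReal
  have heq : ∫⁻ ω, ENNReal.ofReal (((Q n).rnDeriv (P n) ω).toReal ^ 2) ∂P n =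
      ∫⁻ ω, ((Q n).rnDeriv (P n) ω) ^ 2 ∂P n := by
    refine lintegral_congr_ae ?_
    filter_upwards [Measure.rnDeriv_ne_top (Q n) (P n)] with ω hω
    rw [ENNReal.ofReal_pow ENNReal.toReal_nonneg, ENNReal.ofReal_toReal hω]
  constructor
  · rw [memLp_two_iff_integrable_sq hm.aestronglyMeasurable]
    refine ⟨(hm.pow_const 2).aestronglyMeasurable, ?_⟩
    rw [hasFiniteIntegral_iff_ofReal (ae_of_all _ fun ω => sq_nonneg _), heq]
    exact hn.trans ENNReal.ofReal_lt_top
  · rw [integral_eq_lintegral_of_nonneg_ae (ae_of_all _ fun ω => sq_nonneg _)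
      (hm.pow_const 2).aestronglyMeasurable, heq]
    exact (ENNReal.lt_ofReal_iff_toReal_lt hn.ne_top).1 hn

/-- Convergence in distribution from approximation in `L²` by statistics whose limit laws are
close to `ν`. -/
lemma tendstoInDist_of_forall_approx {Ω : ℕ → Type*} [∀ n, MeasurableSpace (Ω n)]
    {P : ∀ n, Measure (Ω n)} [∀ n, IsProbabilityMeasure (P n)]
    {Y : ∀ n, Ω n → ℝ} (hY : ∀ n, Measurable (Y n)) {ν : Measure ℝ} [IsProbabilityMeasure ν]
    (happrox : ∀ g : BoundedContinuousFunction ℝ ℝ, ∀ ε > 0, ∃ X : ∀ n, Ω n → ℝ, ∃ l : ℝ,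
      (∀ᶠ n in atTop, MemLp (fun ω => Y n ω - X n ω) 2 (P n) ∧
        ∫ ω, (Y n ω - X n ω) ^ 2 ∂P n < ε) ∧
      Tendsto (fun n => ∫ ω, g (X n ω) ∂P n) atTop (𝓝 l) ∧
      |l - ∫ y, g y ∂ν| < ε) :
    TendstoInDist P Y ν := by
  have hYp : ∀ n, IsProbabilityMeasure ((P n).map (Y n)) := fun n =>
    Measure.isProbabilityMeasure_map (hY n).aemeasurable
  have hlip : ∀ f : ℝ → ℝ, (∃ C : ℝ, ∀ x y, dist (f x) (f y) ≤ C) → (∃ L, LipschitzWith L f) →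
      Tendsto (fun n => ∫ ω, f ω ∂((P n).map (Y n))) atTop (𝓝 (∫ ω, f ω ∂ν)) := by
    rintro f ⟨B, hB⟩ ⟨L, hL⟩
    let g : BoundedContinuousFunction ℝ ℝ := ⟨⟨f, hL.continuous⟩, B, hB⟩
    have hg : ∀ x, f x = g x := fun _ => rfl
    rw [Metric.tendsto_atTop']
    intro δ hδ
    have hL0 : (0 : ℝ) ≤ L := L.2
    set a : ℝ := δ / (4 * (L + 1)) with ha
    have ha0 : 0 < a := by positivity
    have haL : (L : ℝ) * a ≤ δ / 4 := by
      rw [ha, mul_div_assoc', div_le_div_iff₀ (by positivity) (by norm_num)]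
      nlinarith
    obtain ⟨X, l, hX, hl, hlν⟩ := happrox g (min (a ^ 2) (δ / 4)) (by positivity)
    have hl' := hl.eventually (Metric.ball_mem_nhds l (show 0 < δ / 4 by positivity))
    have := (hX.and hl')
    obtain ⟨n₀, hn₀⟩ := eventually_atTop.1 this
    refine ⟨n₀, fun n hn => ?_⟩
    obtain ⟨⟨hmem, hsq⟩, hball⟩ := hn₀ n hn.le
    rw [integral_map (hY n).aemeasurable hL.continuous.aestronglyMeasurable]
    have hXm : AEStronglyMeasurable (X n) (P n) := by
      have := (hY n).aestronglyMeasurable.sub hmem.aestronglyMeasurable (μ := P n)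
      refine this.congr (ae_of_all _ fun ω => ?_)
      simp
    have hgX : Integrable (fun ω => g (X n ω)) (P n) :=
      Integrable.of_bound (g.continuous.comp_aestronglyMeasurable hXm) ‖g‖
        (ae_of_all _ fun ω => g.norm_coe_le_norm _)
    have hgY : Integrable (fun ω => g (Y n ω)) (P n) :=
      Integrable.of_bound (g.continuous.comp_aestronglyMeasurable (hY n).aestronglyMeasurable) ‖g‖
        (ae_of_all _ fun ω => g.norm_coe_le_norm _)
    have habs : Integrable (fun ω => |Y n ω - X n ω|) (P n) :=
      (hmem.integrable (by norm_num)).abs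
    have hfirst : ∫ ω, |Y n ω - X n ω| ∂P n ≤ a := by
      have h1 : ∫ ω, 2 * a * |Y n ω - X n ω| ∂P n ≤
          ∫ ω, (a ^ 2 + (Y n ω - X n ω) ^ 2) ∂P n := by
        refine integral_mono (habs.const_mul _)
          ((integrable_const _).add hmem.integrable_sq) fun ω => ?_
        have := sq_nonneg (a - |Y n ω - X n ω|)
        have h2 := sq_abs (Y n ω - X n ω)
        simp only
        nlinarith
      rw [integral_const_mul, integral_add (integrable_const _) hmem.integrable_sq] at h1
      simp only [integral_const, probReal_univ, smul_eq_mul, one_mul] at h1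
      have := hsq.trans_le (min_le_left _ _)
      by_contra! hcon
      nlinarith
    have hdiff : |∫ ω, g (Y n ω) ∂P n - ∫ ω, g (X n ω) ∂P n| ≤ δ / 4 := by
      rw [← integral_sub hgY hgX]
      calc |∫ ω, (g (Y n ω) - g (X n ω)) ∂P n| ≤ ∫ ω, |g (Y n ω) - g (X n ω)| ∂P n :=
            abs_integral_le_integral_abs
        _ ≤ ∫ ω, L * |Y n ω - X n ω| ∂P n := by
            refine integral_mono (hgY.sub hgX).abs (habs.const_mul _) fun ω => ?_
            exact hL.dist_le_mul (Y n ω) (X n ω)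
        _ ≤ δ / 4 := by
            rw [integral_const_mul]
            exact (mul_le_mul_of_nonneg_left hfirst hL0).trans haL
    have h3 := hlν.trans_le (min_le_right _ _)
    rw [Real.dist_eq] at hball ⊢
    simp_rw [hg]
    have e : ∫ ω, g (Y n ω) ∂P n - ∫ ω, g ω ∂ν =
        (∫ ω, g (Y n ω) ∂P n - ∫ ω, g (X n ω) ∂P n) + (∫ ω, g (X n ω) ∂P n - l)
          + (l - ∫ ω, g ω ∂ν) := by ring
    rw [e]
    refine (abs_add_three _ _ _).trans_lt ?_
    linarith
  have := (tendsto_iff_forall_lipschitz_integral_tendsto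
    (μs := fun n => (⟨(P n).map (Y n), hYp n⟩ : ProbabilityMeasure ℝ))
    (μ := (⟨ν, inferInstance⟩ : ProbabilityMeasure ℝ))).2 hlip
  intro g
  refine (ProbabilityMeasure.tendsto_iff_forall_integral_tendsto.1 this g).congr fun n => ?_
  exact integral_map (hY n).aemeasurable (by fun_prop)

lemma tendsto_measure_zero_of_integral_sq_rnDeriv_lt {Ω : ℕ → Type*}
    [∀ n, MeasurableSpace (Ω n)] {P Q : ∀ n, Measure (Ω n)} [∀ n, IsProbabilityMeasure (P n)]
    [∀ n, IsProbabilityMeasure (Q n)] (habs : ∀ n, Q n ≪ P n) {C : ℝ}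
    (hY : ∀ᶠ n in atTop, MemLp (fun ω => ((Q n).rnDeriv (P n) ω).toReal) 2 (P n) ∧
      ∫ ω, ((Q n).rnDeriv (P n) ω).toReal ^ 2 ∂P n < C)
    {A : ∀ n, Set (Ω n)} (hA : ∀ n, MeasurableSet (A n))
    (h : Tendsto (fun n => P n (A n)) atTop (𝓝 0)) :
    Tendsto (fun n => Q n (A n)) atTop (𝓝 0) := by
  have hPr : Tendsto (fun n => (P n).real (A n)) atTop (𝓝 0) :=
    (ENNReal.tendsto_toReal_zero_iff fun n => measure_ne_top _ _).2 h
  refine (ENNReal.tendsto_toReal_zero_iff fun n => measure_ne_top _ _).1 ?_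
  have hC : 0 < C := by
    obtain ⟨n, -, hn⟩ := hY.exists
    exact (integral_nonneg fun ω => sq_nonneg _).trans_lt hn
  have hbound : ∀ δ > 0, ∀ᶠ n in atTop,
      (Q n).real (A n) ≤ δ * C + δ⁻¹ * (P n).real (A n) := by
    intro δ hδ
    filter_upwards [hY] with n ⟨hL, hlt⟩
    rw [← Measure.setIntegral_toReal_rnDeriv (habs n), ← integral_indicator (hA n)]
    have hind : Integrable ((A n).indicator fun _ => δ⁻¹) (P n) :=
      (integrable_const _).indicator (hA n)
    calc ∫ ω, (A n).indicator (fun ω => ((Q n).rnDeriv (P n) ω).toReal) ω ∂P n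
        ≤ ∫ ω, (δ * ((Q n).rnDeriv (P n) ω).toReal ^ 2 +
            (A n).indicator (fun _ => δ⁻¹) ω) ∂P n := by
          refine integral_mono ((hL.integrable (by norm_num)).indicator (hA n))
            ((hL.integrable_sq.const_mul δ).add hind) fun ω => ?_
          by_cases hω : ω ∈ A n
          · simp only [hω, Set.indicator_of_mem]
            set y := ((Q n).rnDeriv (P n) ω).toReal
            have h1 : 0 ≤ δ * (y - δ⁻¹) ^ 2 := by positivity
            have h2 : δ * (y - δ⁻¹) ^ 2 = δ * y ^ 2 + δ⁻¹ - 2 * y := by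
              field_simp
              ring
            have h3 : 0 ≤ y := ENNReal.toReal_nonneg
            linarith
          · simp only [hω, not_false_eq_true, Set.indicator_of_notMem, add_zero]
            positivity
      _ = δ * ∫ ω, ((Q n).rnDeriv (P n) ω).toReal ^ 2 ∂P n + δ⁻¹ * (P n).real (A n) := by
          rw [integral_add (hL.integrable_sq.const_mul δ) hind, integral_const_mul,
            integral_indicator (hA n), setIntegral_const, smul_eq_mul, mul_comm δ⁻¹]
      _ ≤ _ := by gcongr
  refine tendsto_order.2 ⟨fun a ha => Eventually.of_forall fun n =>
    ha.trans_le measureReal_nonneg, fun a ha => ?_⟩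
  have hlim : Tendsto (fun n => a / (2 * C) * C + (a / (2 * C))⁻¹ * (P n).real (A n)) atTop
      (𝓝 (a / (2 * C) * C + (a / (2 * C))⁻¹ * 0)) := (hPr.const_mul _).const_add _
  have hlt : a / (2 * C) * C + (a / (2 * C))⁻¹ * 0 < a := by
    have : a / (2 * C) * C = a / 2 := by field_simp
    rw [this]
    linarith
  filter_upwards [hbound (a / (2 * C)) (by positivity), hlim.eventually_lt_const hlt]
    with n h1 h2
  exact h1.trans_lt h2

/-- A continuous cutoff equal to `1` on `(-∞, 1 / (j + 1)]` and to `0` on `[2 / (j + 1), ∞)`. -/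
def cutoff (j : ℕ) : BoundedContinuousFunction ℝ ℝ :=
  BoundedContinuousFunction.ofNormedAddCommGroup (fun y => max 0 (min 1 (2 - (j + 1) * y)))
    (by fun_prop) 1 fun y => by
      rw [Real.norm_of_nonneg (le_max_left _ _)]
      exact max_le zero_le_one (min_le_left _ _)

lemma cutoff_apply (j : ℕ) (y : ℝ) : cutoff j y = max 0 (min 1 (2 - (j + 1) * y)) := rfl

lemma cutoff_nonneg (j : ℕ) (y : ℝ) : 0 ≤ cutoff j y := le_max_left _ _

lemma tendsto_integral_cutoff {ν : Measure ℝ} [IsProbabilityMeasure ν]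
    (hν : ∀ᵐ y ∂ν, 0 < y) : Tendsto (fun j => ∫ y, cutoff j y ∂ν) atTop (𝓝 0) := by
  rw [← integral_zero ℝ ℝ (μ := ν)]
  refine tendsto_integral_of_dominated_convergence (fun _ => 1)
    (fun j => by fun_prop) (integrable_const _) ?_ ?_
  · intro j
    filter_upwards with y
    rw [Real.norm_of_nonneg (cutoff_nonneg j y)]
    exact max_le zero_le_one (min_le_left _ _)
  · filter_upwards [hν] with y hy
    refine tendsto_const_nhds.congr' ?_
    filter_upwards [eventually_ge_atTop ⌈2 / y⌉₊] with j hj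
    have h1 : 2 / y ≤ j := (Nat.le_ceil _).trans (by exact_mod_cast hj)
    rw [div_le_iff₀ hy] at h1
    rw [cutoff_apply, max_eq_left]
    exact (min_le_right _ _).trans (by linarith)

lemma tendsto_measure_zero_of_tendstoInDist_rnDeriv {Ω : ℕ → Type*}
    [∀ n, MeasurableSpace (Ω n)] {P Q : ∀ n, Measure (Ω n)} [∀ n, IsProbabilityMeasure (P n)]
    [∀ n, IsProbabilityMeasure (Q n)] (habs : ∀ n, Q n ≪ P n) {ν : Measure ℝ}
    [IsProbabilityMeasure ν] (hν : ∀ᵐ y ∂ν, 0 < y)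
    (hY : TendstoInDist P (fun n ω => ((Q n).rnDeriv (P n) ω).toReal) ν)
    {A : ∀ n, Set (Ω n)} (hA : ∀ n, MeasurableSet (A n))
    (h : Tendsto (fun n => Q n (A n)) atTop (𝓝 0)) :
    Tendsto (fun n => P n (A n)) atTop (𝓝 0) := by
  have hQr : Tendsto (fun n => (Q n).real (A n)) atTop (𝓝 0) :=
    (ENNReal.tendsto_toReal_zero_iff fun n => measure_ne_top _ _).2 h
  refine (ENNReal.tendsto_toReal_zero_iff fun n => measure_ne_top _ _).1 ?_
  have hbound : ∀ (j n : ℕ), (P n).real (A n) ≤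
      ∫ ω, cutoff j ((Q n).rnDeriv (P n) ω).toReal ∂P n + (j + 1) * (Q n).real (A n) := by
    intro j n
    have hm : Measurable fun ω => ((Q n).rnDeriv (P n) ω).toReal :=
      (Measure.measurable_rnDeriv _ _).ennreal_toReal
    have hc : Integrable (fun ω => cutoff j ((Q n).rnDeriv (P n) ω).toReal) (P n) :=
      Integrable.of_bound
        ((cutoff j).continuous.comp_aestronglyMeasurable hm.aestronglyMeasurable) ‖cutoff j‖
        (ae_of_all _ fun ω => (cutoff j).norm_coe_le_norm _)
    have hi : Integrable ((A n).indicator fun ω => ((Q n).rnDeriv (P n) ω).toReal) (P n) :=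
      Measure.integrable_toReal_rnDeriv.indicator (hA n)
    rw [← Measure.setIntegral_toReal_rnDeriv (habs n), ← integral_indicator (hA n),
      ← integral_const_mul, ← integral_add hc (hi.const_mul _), ← integral_indicator_one (hA n)]
    refine integral_mono ((integrable_const _).indicator (hA n))
      (hc.add (hi.const_mul _)) fun ω => ?_
    by_cases hω : ω ∈ A n
    · simp only [hω, Set.indicator_of_mem, Pi.one_apply, cutoff_apply]
      set y := ((Q n).rnDeriv (P n) ω).toReal
      have h3 : 0 ≤ (j + 1) * y := mul_nonneg (by positivity) ENNReal.toReal_nonneg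
      rcases le_total ((j + 1) * y) 1 with h1 | h1
      · rw [min_eq_left (by linarith), max_eq_right zero_le_one]
        linarith
      · have := le_max_left 0 (min 1 (2 - (j + 1) * y))
        linarith
    · simp only [hω, not_false_eq_true, Set.indicator_of_notMem, mul_zero, add_zero]
      exact cutoff_nonneg _ _
  refine tendsto_order.2 ⟨fun a ha => Eventually.of_forall fun n =>
    ha.trans_le measureReal_nonneg, fun a ha => ?_⟩
  obtain ⟨j, hj⟩ := ((tendsto_integral_cutoff hν).eventually_lt_const ha).exists
  have hlim := (hY (cutoff j)).add (hQr.const_mul ((j : ℝ) + 1))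
  rw [mul_zero, add_zero] at hlim
  filter_upwards [hlim.eventually_lt_const hj] with n hn
  exact (hbound j n).trans_lt hn

/-- The truncation at level `M` of the density of `⨂ N(μ i, v i)` with respect to
`⨂ N(0, v i)`. -/
def truncLR {ι : Type*} [Fintype ι] (μ v : ι → ℝ) (M : ℕ) :
    BoundedContinuousFunction (ι → ℝ) ℝ :=
  BoundedContinuousFunction.ofNormedAddCommGroup (fun x => truncExp M (logLR μ v x))
    (by fun_prop) M fun x => by
      rw [Real.norm_of_nonneg (truncExp_nonneg _ _)]
      exact min_le_right _ _

lemma integral_comp_truncLR {ι : Type*} [Fintype ι] (μ v m : ι → ℝ) (hv : ∀ i, 0 < v i)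
    (M : ℕ) {φ : ℝ → ℝ} (hφ : Continuous φ) :
    ∫ x, φ (truncLR μ v M x) ∂(Measure.pi fun i => gaussianReal (m i) (v i).toNNReal) =
      ∫ y, φ (truncExp M y) ∂gaussianReal (∑ i, (μ i / v i * m i - μ i ^ 2 / v i / 2))
        (∑ i, μ i ^ 2 / v i).toNNReal := by
  rw [← map_logLR μ v m hv, integral_map (by fun_prop) (by fun_prop)]
  rfl

lemma tendsto_integral_truncLR {ι : Type*} [Fintype ι] (μ v : ι → ℝ) (hv : ∀ i, 0 < v i) :
    Tendsto (fun M => ∫ x, truncLR μ v M x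
        ∂(Measure.pi fun i => gaussianReal (μ i) (v i).toNNReal)) atTop
      (𝓝 (Real.exp (∑ i, μ i ^ 2 / v i))) := by
  have hs : 0 ≤ ∑ i, μ i ^ 2 / v i :=
    Finset.sum_nonneg fun i _ => div_nonneg (sq_nonneg _) (hv i).le
  have hm : ∑ i, (μ i / v i * μ i - μ i ^ 2 / v i / 2) = (∑ i, μ i ^ 2 / v i) / 2 := by
    rw [Finset.sum_div]
    refine Finset.sum_congr rfl fun i _ => ?_
    ring
  have h := tendsto_integral_truncExp ((∑ i, μ i ^ 2 / v i) / 2) (∑ i, μ i ^ 2 / v i).toNNReal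
  rw [Real.coe_toNNReal _ hs, add_halves] at h
  refine h.congr fun M => ?_
  have := integral_comp_truncLR μ v μ hv M continuous_id
  rw [hm] at this
  exact this.symm

lemma tendsto_integral_truncLR_sq {ι : Type*} [Fintype ι] (μ v : ι → ℝ) (hv : ∀ i, 0 < v i) :
    Tendsto (fun M => ∫ x, truncLR μ v M x ^ 2
        ∂(Measure.pi fun i => gaussianReal 0 (v i).toNNReal)) atTop
      (𝓝 (Real.exp (∑ i, μ i ^ 2 / v i))) := by
  have hs : 0 ≤ ∑ i, μ i ^ 2 / v i :=
    Finset.sum_nonneg fun i _ => div_nonneg (sq_nonneg _) (hv i).le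
  have h := tendsto_integral_truncExp_sq (-((∑ i, μ i ^ 2 / v i) / 2))
    (∑ i, μ i ^ 2 / v i).toNNReal
  rw [Real.coe_toNNReal _ hs, show ∀ s : ℝ, 2 * -(s / 2) + 2 * s = s by intro s; ring] at h
  refine h.congr fun M => ?_
  rw [integral_comp_truncLR μ v (fun _ => 0) hv M (continuous_pow 2)]
  simp [Finset.sum_div]

lemma tendsto_integral_comp_truncLR {ι : Type*} [Fintype ι] (μ v : ι → ℝ) (hv : ∀ i, 0 < v i)
    (g : BoundedContinuousFunction ℝ ℝ) :
    Tendsto (fun M => ∫ x, g (truncLR μ v M x)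
        ∂(Measure.pi fun i => gaussianReal 0 (v i).toNNReal)) atTop
      (𝓝 (∫ y, g (Real.exp y) ∂gaussianReal (-((∑ i, μ i ^ 2 / v i) / 2))
        (∑ i, μ i ^ 2 / v i).toNNReal)) := by
  refine (tendsto_integral_comp_truncExp g _ _).congr fun M => ?_
  rw [integral_comp_truncLR μ v (fun _ => 0) hv M g.continuous]
  simp [Finset.sum_div]

end JansonSecondMoment

open JansonSecondMoment

theorem janson_second_moment_method
    {Ω : ℕ → Type*} [∀ n, MeasurableSpace (Ω n)]
    (P Q : ∀ n, Measure (Ω n))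
    [∀ n, IsProbabilityMeasure (P n)] [∀ n, IsProbabilityMeasure (Q n)]
    -- the statistics `W_{n,i}` (here `i : ℕ` indexes the `(i+1)`-st statistic)
    (W : ∀ n, ℕ → Ω n → ℝ)
    -- means `μ_i` and variances `σ_i² = v i > 0` of the Gaussian limits
    (μ : ℕ → ℝ) (v : ℕ → ℝ) (hv : ∀ i, 0 < v i)
    -- (i) `Q_n ≪ P_n` for every `n`
    (habs : ∀ n, Q n ≪ P n)
    -- (ii)+(iii) for every fixed `k`, `(W_{n,1},…,W_{n,k})` converges in
    -- distribution under `P_n` to independent `Z_i ~ N(0, σ_i²)`: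
    (hWP : ∀ k : ℕ, TendstoInDist P (fun n ω => fun i : Fin k => W n i ω)
      (Measure.pi fun i : Fin k => gaussianReal 0 (v i).toNNReal))
    -- and under `Q_n` to independent `Z'_i ~ N(μ_i, σ_i²)`:
    (hWQ : ∀ k : ℕ, TendstoInDist Q (fun n ω => fun i : Fin k => W n i ω)
      (Measure.pi fun i : Fin k => gaussianReal (μ i) (v i).toNNReal))
    -- (iv) the second moment condition on `Y_n = dQ_n/dP_n`:
    (hsum : Summable fun i => μ i ^ 2 / v i)
    (hsecond : Filter.limsup
        (fun n => ∫⁻ ω, ((Q n).rnDeriv (P n) ω) ^ 2 ∂P n) atTop ≤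
      ENNReal.ofReal (Real.exp (∑' i, μ i ^ 2 / v i))) :
    -- then `P_n` and `Q_n` are asymptotically mutually contiguous:
    (∀ A : ∀ n, Set (Ω n), (∀ n, MeasurableSet (A n)) →
      ((Tendsto (fun n => P n (A n)) atTop (𝓝 0) →
        Tendsto (fun n => Q n (A n)) atTop (𝓝 0)) ∧
      (Tendsto (fun n => Q n (A n)) atTop (𝓝 0) →
        Tendsto (fun n => P n (A n)) atTop (𝓝 0)))) ∧
    -- and under `P_n`, `Y_n` converges in distribution to
    -- `exp{Σ_i (μ_i Z_i − ½μ_i²)/σ_i²}` with `Z_i` independent `N(0, σ_i²)`,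
    -- i.e. to the log-normal distribution
    -- `exp(N(−½ Σ_i μ_i²/σ_i², Σ_i μ_i²/σ_i²))`:
    TendstoInDist P (fun n ω => ((Q n).rnDeriv (P n) ω).toReal)
      ((gaussianReal (-((∑' i, μ i ^ 2 / v i) / 2))
        (∑' i, μ i ^ 2 / v i).toNNReal).map Real.exp) := by
  set S : ℝ := ∑' i, μ i ^ 2 / v i with hS
  have hterm : ∀ i, 0 ≤ μ i ^ 2 / v i := fun i => div_nonneg (sq_nonneg _) (hv i).le
  have hY : ∀ C' > Real.exp S, ∀ᶠ n in atTop,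
      MemLp (fun ω => ((Q n).rnDeriv (P n) ω).toReal) 2 (P n) ∧
        ∫ ω, ((Q n).rnDeriv (P n) ω).toReal ^ 2 ∂P n < C' := fun C' hC' =>
    eventually_memLp_rnDeriv (Real.exp_pos S).le hsecond hC'
  have hν : IsProbabilityMeasure ((gaussianReal (-(S / 2)) S.toNNReal).map Real.exp) :=
    Measure.isProbabilityMeasure_map (by fun_prop)
  have hpartial : Tendsto (fun k : ℕ => ∑ i : Fin k, μ i ^ 2 / v i) atTop (𝓝 S) := by
    simpa only [Fin.sum_univ_eq_sum_range (fun i => μ i ^ 2 / v i)]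
      using hsum.hasSum.tendsto_sum_nat
  have hdist : TendstoInDist P (fun n ω => ((Q n).rnDeriv (P n) ω).toReal)
      ((gaussianReal (-(S / 2)) S.toNNReal).map Real.exp) := by
    refine tendstoInDist_of_forall_approx
      (fun n => (Measure.measurable_rnDeriv _ _).ennreal_toReal) fun g ε hε => ?_
    have hlaw : Tendsto (fun k : ℕ => ∫ y, g (Real.exp y) ∂gaussianReal
        (-((∑ i : Fin k, μ i ^ 2 / v i) / 2)) (∑ i : Fin k, μ i ^ 2 / v i).toNNReal) atTop
        (𝓝 (∫ y, g (Real.exp y) ∂gaussianReal (-(S / 2)) S.toNNReal)) :=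
      tendsto_integral_gaussianReal (g.compContinuous ⟨Real.exp, Real.continuous_exp⟩)
        (fun k => Finset.sum_nonneg fun i _ => hterm i) (hpartial.div_const 2).neg hpartial
    have hexp : Tendsto (fun k : ℕ => Real.exp S - Real.exp (∑ i : Fin k, μ i ^ 2 / v i)) atTop
        (𝓝 0) := by
      simpa using ((Real.continuous_exp.tendsto S).comp hpartial).const_sub (Real.exp S)
    obtain ⟨k, hk1, hk2⟩ := ((hexp.eventually_lt_const hε).and
      (hlaw.eventually (Metric.ball_mem_nhds _ hε))).exists
    have hM1 := ((tendsto_integral_truncLR (fun i : Fin k => μ i) (fun i => v i)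
        fun i => hv i).const_mul 2).const_sub (Real.exp S) |>.add
      (tendsto_integral_truncLR_sq (fun i : Fin k => μ i) (fun i => v i) fun i => hv i)
    have hM2 := tendsto_integral_comp_truncLR (fun i : Fin k => μ i) (fun i => v i)
      (fun i => hv i) g
    obtain ⟨M, h1, h2⟩ := ((hM1.eventually_lt_const (u := ε) (by linarith)).and
      (hM2.eventually (Metric.isOpen_ball.mem_nhds hk2))).exists
    refine ⟨fun n ω => truncLR (fun i : Fin k => μ i) (fun i => v i) M (fun i => W n i ω), _,
      eventually_integral_rnDeriv_sub_sq_lt habs (hWP k) (hWQ k) hY _ h1,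
      hWP k (g.compContinuous
        ⟨_, (truncLR (fun i : Fin k => μ i) (fun i => v i) M).continuous⟩), ?_⟩
    rw [integral_map (by fun_prop) (by fun_prop), ← Real.dist_eq]
    exact h2
  have hpos : ∀ᵐ y ∂(gaussianReal (-(S / 2)) S.toNNReal).map Real.exp, 0 < y := by
    rw [ae_map_iff (by fun_prop) measurableSet_Ioi]
    exact ae_of_all _ Real.exp_pos
  refine ⟨fun A hA => ⟨fun h => ?_, fun h => ?_⟩, hdist⟩
  · exact tendsto_measure_zero_of_integral_sq_rnDeriv_lt habs
      (hY (Real.exp S + 1) (lt_add_one _)) hA h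
  · exact tendsto_measure_zero_of_tendstoInDist_rnDeriv habs hpos hdist hA h
end
end

section
/- (Asymptotic variance of bipartite signed cycles under the null.) Let X ∈ ℝ^{n×p} have entries X_{ij} i.i.d. N(0,1) and suppose p/n → γ ∈ (0,∞) as n → ∞. Then Var(B_{n,1}) → 2γ, and for every fixed integer k ≥ 2, Var(B_{n,k}) = (1 + o(1)) · 2kγ^k as n → ∞. -/
/- Statement 13: asymptotic variance of bipartite signed cycles under the null. -/

open MeasureTheory ProbabilityTheory Filter Topology

noncomputable section

/-- The type of `n × p` real data arrays. -/
abbrev DataMat (n p : ℕ) := Fin n → Fin p → ℝ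

/-- Null distribution: all entries i.i.d. standard Gaussian `N(0,1)`. -/
def nullMeasure (n p : ℕ) : Measure (DataMat n p) :=
  Measure.pi fun _ : Fin n => Measure.pi fun _ : Fin p => gaussianReal 0 1

/-- The bipartite signed cycle of length `2k`:
`B_{n,k} = n^{-k} Σ X_{i₀j₀} X_{i₁j₀} X_{i₁j₁} X_{i₂j₁} ⋯ X_{i_{k-1}j_{k-1}} X_{i₀j_{k-1}}`,
the sum running over pairwise distinct `i₀,…,i_{k-1} ∈ [n]` and pairwise
distinct `j₀,…,j_{k-1} ∈ [p]`. -/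
def cycleStat {n p : ℕ} (X : Fin n → Fin p → ℝ) (k : ℕ) : ℝ :=
  (1 / (n : ℝ) ^ k) *
    ∑ i : Fin k → Fin n, ∑ j : Fin k → Fin p,
      if Function.Injective i ∧ Function.Injective j then
        ∏ a : Fin k, X (i a) (j a) * X (i ⟨((a : ℕ) + 1) % k, Nat.mod_lt _ a.pos⟩) (j a)
      else 0

/-- The cells visited by the closed walk with row labels `q.1` and column labels `q.2`. -/
def cycleCells {n p k : ℕ} (q : (Fin (k + 2) → Fin n) × (Fin (k + 2) → Fin p)) :
    Finset (Fin n × Fin p) :=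
  Finset.univ.image (fun a => (q.1 a, q.2 a)) ∪ Finset.univ.image (fun a => (q.1 (a + 1), q.2 a))

/-- The pairs of injective labellings of the rows and columns of a cycle. -/
def cycleLabels (n p k : ℕ) : Finset ((Fin k → Fin n) × (Fin k → Fin p)) :=
  Finset.univ.filter fun q => Function.Injective q.1 ∧ Function.Injective q.2

/-- The action of the automorphisms of a bipartite cycle (rotations and reflections) on
labellings. -/
def relabel {n p k : ℕ} (q : (Fin (k + 2) → Fin n) × (Fin (k + 2) → Fin p))
    (r : Bool × Fin (k + 2)) : (Fin (k + 2) → Fin n) × (Fin (k + 2) → Fin p) :=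
  if r.1 then (fun a => q.1 (r.2 - a), fun a => q.2 (r.2 - 1 - a))
  else (fun a => q.1 (r.2 + a), fun a => q.2 (r.2 + a))

section Combinatorics

variable {n p k : ℕ}

lemma mem_cycleLabels {q : (Fin k → Fin n) × (Fin k → Fin p)} :
    q ∈ cycleLabels n p k ↔ Function.Injective q.1 ∧ Function.Injective q.2 := by
  simp [cycleLabels]

lemma mem_cycleCells {q : (Fin (k + 2) → Fin n) × (Fin (k + 2) → Fin p)} {e : Fin n × Fin p} :
    e ∈ cycleCells q ↔ ∃ a, (q.1 a, q.2 a) = e ∨ (q.1 (a + 1), q.2 a) = e := by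
  simp [cycleCells, exists_or]

/-- Induction along the cyclic order of `Fin (k + 2)`. -/
lemma fin_cyclic_induction {P : Fin (k + 2) → Prop} (zero : P 0) (add_one : ∀ t, P t → P (t + 1))
    (t : Fin (k + 2)) : P t := by
  induction t using Fin.induction with
  | zero => exact zero
  | succ i ih =>
    rw [← Fin.coeSucc_eq_succ]
    exact add_one _ ih

lemma add_one_ne_self_fin (a : Fin (k + 2)) : a + 1 ≠ a := by
  simp

lemma prod_cycleCells {q : (Fin (k + 2) → Fin n) × (Fin (k + 2) → Fin p)}
    (hq : q ∈ cycleLabels n p (k + 2)) (x : Fin n → Fin p → ℝ) :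
    ∏ e ∈ cycleCells q, x e.1 e.2 = ∏ a, x (q.1 a) (q.2 a) * x (q.1 (a + 1)) (q.2 a) := by
  obtain ⟨h₁, h₂⟩ := mem_cycleLabels.1 hq
  rw [cycleCells, Finset.prod_union, Finset.prod_image, Finset.prod_image,
    Finset.prod_mul_distrib]
  · intro a _ b _ h
    exact h₂ (Prod.ext_iff.1 h).2
  · intro a _ b _ h
    exact h₂ (Prod.ext_iff.1 h).2
  · rw [Finset.disjoint_left]
    simp only [Finset.mem_image, Finset.mem_univ, true_and, not_exists]
    rintro _ ⟨a, rfl⟩ b h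
    obtain ⟨h, h'⟩ := Prod.ext_iff.1 h
    exact add_one_ne_self_fin b ((h₁ h).trans (h₂ h').symm)

lemma cycleCells_nonempty (q : (Fin (k + 2) → Fin n) × (Fin (k + 2) → Fin p)) :
    (cycleCells q).Nonempty :=
  ⟨_, mem_cycleCells.2 ⟨0, Or.inl rfl⟩⟩

lemma cycleStat_eq_sum_prod (x : Fin n → Fin p → ℝ) :
    cycleStat x (k + 2) =
      1 / (n : ℝ) ^ (k + 2) * ∑ q ∈ cycleLabels n p (k + 2), ∏ e ∈ cycleCells q, x e.1 e.2 := by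
  rw [Finset.sum_congr rfl fun q hq => prod_cycleCells hq x, cycleLabels, Finset.sum_filter,
    cycleStat, ← Finset.univ_product_univ, Finset.sum_product]
  have h (a : Fin (k + 2)) :
      (⟨((a : ℕ) + 1) % (k + 2), Nat.mod_lt _ a.pos⟩ : Fin (k + 2)) = a + 1 := by
    ext
    simp [Fin.val_add]
  simp only [h]

lemma relabel_mem {q : (Fin (k + 2) → Fin n) × (Fin (k + 2) → Fin p)}
    (hq : q ∈ cycleLabels n p (k + 2)) (r : Bool × Fin (k + 2)) :
    relabel q r ∈ cycleLabels n p (k + 2) := by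
  obtain ⟨h₁, h₂⟩ := mem_cycleLabels.1 hq
  rw [mem_cycleLabels]
  obtain ⟨_ | _, s⟩ := r
  · exact ⟨fun a b h => add_left_cancel (h₁ h), fun a b h => add_left_cancel (h₂ h)⟩
  · exact ⟨fun a b h => sub_right_injective (h₁ h), fun a b h => sub_right_injective (h₂ h)⟩

lemma cycleCells_relabel (q : (Fin (k + 2) → Fin n) × (Fin (k + 2) → Fin p))
    (r : Bool × Fin (k + 2)) : cycleCells (relabel q r) = cycleCells q := by
  ext e
  rw [mem_cycleCells, mem_cycleCells]
  obtain ⟨_ | _, s⟩ := r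
  · simp only [relabel, Bool.false_eq_true, if_false]
    exact (Equiv.addLeft s).exists_congr fun a => by simp [add_assoc]
  · simp only [relabel, if_true]
    have h (a : Fin (k + 2)) : s - 1 - a + 1 = s - a := by abel
    have h' (a : Fin (k + 2)) : s - (a + 1) = s - 1 - a := by abel
    exact (Equiv.subLeft (s - 1)).exists_congr fun a => by simp [h, h', or_comm]

lemma relabel_injective {q : (Fin (k + 2) → Fin n) × (Fin (k + 2) → Fin p)}
    (hq : q ∈ cycleLabels n p (k + 2)) : Function.Injective (relabel q) := by
  obtain ⟨h₁, h₂⟩ := mem_cycleLabels.1 hq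
  rintro ⟨_ | _, s⟩ ⟨_ | _, t⟩ h <;>
    simp only [relabel, Bool.false_eq_true, if_true, if_false] at h <;>
    have e₁ := h₁ (congrFun (Prod.ext_iff.1 h).1 0) <;>
    have e₂ := h₂ (congrFun (Prod.ext_iff.1 h).2 0) <;>
    simp_all

/-- A labelling whose cells are all cells of `q` is a relabelling of `q`. -/
lemma exists_relabel {q q' : (Fin (k + 2) → Fin n) × (Fin (k + 2) → Fin p)}
    (hq : q ∈ cycleLabels n p (k + 2)) (hq' : q' ∈ cycleLabels n p (k + 2))
    (h : cycleCells q' ⊆ cycleCells q) : ∃ r, relabel q r = q' := by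
  obtain ⟨h₁, h₂⟩ := mem_cycleLabels.1 hq
  obtain ⟨h₁', h₂'⟩ := mem_cycleLabels.1 hq'
  have diag (a : Fin (k + 2)) : ∃ b, (q'.2 a = q.2 b) ∧ (q'.1 a = q.1 b ∨ q'.1 a = q.1 (b + 1)) := by
    obtain ⟨b, hb⟩ := mem_cycleCells.1 (h (mem_cycleCells.2 ⟨a, Or.inl rfl⟩))
    simp only [Prod.mk.injEq] at hb
    grind
  have off (a : Fin (k + 2)) :
      ∃ b, (q'.2 a = q.2 b) ∧ (q'.1 (a + 1) = q.1 b ∨ q'.1 (a + 1) = q.1 (b + 1)) := by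
    obtain ⟨b, hb⟩ := mem_cycleCells.1 (h (mem_cycleCells.2 ⟨a, Or.inr rfl⟩))
    simp only [Prod.mk.injEq] at hb
    grind
  obtain ⟨b, hb, hb' | hb'⟩ := diag 0
  · have key (t : Fin (k + 2)) : q.1 (b + t) = q'.1 t ∧ q.2 (b + t) = q'.2 t := by
      induction t using fin_cyclic_induction with
      | zero => simp [hb, hb']
      | add_one t ih =>
        have row : q.1 (b + (t + 1)) = q'.1 (t + 1) := by
          obtain ⟨c, hc, hc' | hc'⟩ := off t
          · have : b + t = c := h₂ (ih.2.trans hc)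
            rw [← this, ih.1] at hc'
            exact absurd (h₁' hc') (add_one_ne_self_fin t)
          · have : b + t = c := h₂ (ih.2.trans hc)
            rw [hc', ← this, add_assoc]
        refine ⟨row, ?_⟩
        obtain ⟨c, hc, hc' | hc'⟩ := diag (t + 1)
        · rw [hc, h₁ (row.trans hc')]
        · have : b + (t + 1) = c + 1 := h₁ (row.trans hc')
          rw [← add_assoc, add_left_inj] at this
          rw [← this, ih.2] at hc
          exact absurd (h₂' hc) (add_one_ne_self_fin t)
    exact ⟨(false, b), Prod.ext (funext fun t => (key t).1) (funext fun t => (key t).2)⟩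
  · have key (t : Fin (k + 2)) : q.1 (b + 1 - t) = q'.1 t ∧ q.2 (b - t) = q'.2 t := by
      induction t using fin_cyclic_induction with
      | zero => simp [hb, hb']
      | add_one t ih =>
        have row : q.1 (b + 1 - (t + 1)) = q'.1 (t + 1) := by
          obtain ⟨c, hc, hc' | hc'⟩ := off t
          · have : b - t = c := h₂ (ih.2.trans hc)
            rw [hc', ← this, add_sub_add_right_eq_sub]
          · have : b - t = c := h₂ (ih.2.trans hc)
            rw [← this, sub_add_eq_add_sub, ih.1] at hc'
            exact absurd (h₁' hc') (add_one_ne_self_fin t)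
        refine ⟨row, ?_⟩
        obtain ⟨c, hc, hc' | hc'⟩ := diag (t + 1)
        · have : b + 1 - (t + 1) = c := h₁ (row.trans hc')
          rw [add_sub_add_right_eq_sub] at this
          rw [← this, ih.2] at hc
          exact absurd (h₂' hc) (add_one_ne_self_fin t)
        · have : b + 1 - (t + 1) = c + 1 := h₁ (row.trans hc')
          rw [hc, ← sub_eq_iff_eq_add.2 this, sub_right_comm, add_sub_cancel_right]
    refine ⟨(true, b + 1), Prod.ext (funext fun t => (key t).1) (funext fun t => ?_)⟩
    simpa [relabel] using (key t).2

lemma card_filter_cycleCells_eq {q : (Fin (k + 2) → Fin n) × (Fin (k + 2) → Fin p)}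
    (hq : q ∈ cycleLabels n p (k + 2)) :
    ((cycleLabels n p (k + 2)).filter fun q' => cycleCells q = cycleCells q').card =
      2 * (k + 2) := by
  have : ((cycleLabels n p (k + 2)).filter fun q' => cycleCells q = cycleCells q') =
      Finset.univ.image (relabel q) := by
    ext q'
    simp only [Finset.mem_filter, Finset.mem_image, Finset.mem_univ, true_and]
    constructor
    · rintro ⟨hq', h⟩
      exact exists_relabel hq hq' h.ge
    · rintro ⟨r, rfl⟩
      exact ⟨relabel_mem hq r, (cycleCells_relabel q r).symm⟩
  rw [this, Finset.card_image_of_injective _ (relabel_injective hq)]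
  simp

lemma card_cycleLabels : (cycleLabels n p k).card = n.descFactorial k * p.descFactorial k := by
  have h (m : ℕ) : (Finset.univ.filter fun f : Fin k → Fin m => Function.Injective f).card =
      m.descFactorial k := by
    rw [← Fintype.card_subtype, Fintype.card_congr (Equiv.subtypeInjectiveEquivEmbedding _ _),
      Fintype.card_embedding_eq]
    simp
  rw [← h n, ← h p, ← Finset.card_product, cycleLabels]
  congr 1
  ext q
  simp

end Combinatorics

section Moments

lemma integrable_pow_gaussianReal (m : ℕ) : Integrable (fun x : ℝ => x ^ m) (gaussianReal 0 1) := by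
  rcases eq_or_ne m 0 with rfl | hm
  · simp
  have := (memLp_id_gaussianReal (μ := 0) (v := 1) m).integrable_norm_pow hm
  refine (integrable_norm_iff (by fun_prop)).1 ?_
  simpa using this

lemma integral_sq_gaussianReal : ∫ x, x ^ 2 ∂gaussianReal 0 1 = 1 := by
  have h := variance_of_integral_eq_zero (X := fun x : ℝ => x) (μ := gaussianReal 0 1)
    (by fun_prop) integral_id_gaussianReal
  rw [variance_fun_id_gaussianReal] at h
  simpa using h.symm

lemma integral_pow_four_gaussianReal : ∫ x, x ^ 4 ∂gaussianReal 0 1 = 3 := by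
  rw [integral_gaussianReal_eq_integral_smul one_ne_zero]
  have h : ∀ x : ℝ, gaussianPDFReal 0 1 x • x ^ 4 =
      (√(2 * Real.pi))⁻¹ * (fun y : ℝ => y ^ (4 : ℝ) * Real.exp (-(1 / 2) * y ^ (2 : ℝ))) |x| := by
    intro x
    have : |x| ^ 4 = x ^ 4 := by rw [← abs_pow]; exact abs_of_nonneg (by positivity)
    simp only [gaussianPDFReal, smul_eq_mul, NNReal.coe_one, mul_one, sub_zero]
    norm_cast
    rw [this, sq_abs]
    ring_nf
  rw [integral_congr_ae (ae_of_all _ h), integral_const_mul,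
    integral_comp_abs (f := fun y : ℝ => y ^ (4 : ℝ) * Real.exp (-(1 / 2) * y ^ (2 : ℝ))),
    integral_rpow_mul_exp_neg_mul_rpow two_pos (by norm_num) (by norm_num)]
  have h₁ : Real.Gamma ((4 + 1) / 2) = 3 / 4 * √Real.pi := by
    have := Real.Gamma_nat_add_half 2
    norm_num [Nat.doubleFactorial] at this ⊢
    rw [this]
    ring
  have h₂ : (1 / 2 : ℝ) ^ (-(4 + 1) / 2 : ℝ) = 4 * √2 := by
    rw [one_div, Real.inv_rpow two_pos.le, ← Real.rpow_neg two_pos.le, Real.sqrt_eq_rpow,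
      show (-(-(4 + 1) / 2) : ℝ) = 2 + 1 / 2 by norm_num, Real.rpow_add two_pos]
    norm_num
  rw [h₁, h₂, Real.sqrt_mul two_pos.le]
  have := Real.sqrt_pos.2 Real.pi_pos
  field_simp

lemma memLp_sq_gaussianReal : MemLp (fun x : ℝ => x ^ 2) 2 (gaussianReal 0 1) := by
  rw [memLp_two_iff_integrable_sq (by fun_prop)]
  simpa [← pow_mul] using integrable_pow_gaussianReal 4

lemma variance_sq_gaussianReal : Var[fun x : ℝ => x ^ 2; gaussianReal 0 1] = 2 := by
  rw [variance_eq_sub memLp_sq_gaussianReal]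
  simp only [Pi.pow_apply, ← pow_mul]
  rw [integral_sq_gaussianReal, integral_pow_four_gaussianReal]
  norm_num

variable {n p : ℕ}

instance : IsProbabilityMeasure (nullMeasure n p) := by
  unfold nullMeasure
  infer_instance

lemma integral_prod_pow_nullMeasure (m : Fin n → Fin p → ℕ) :
    ∫ x, ∏ u, ∏ v, x u v ^ m u v ∂nullMeasure n p =
      ∏ u, ∏ v, ∫ y, y ^ m u v ∂gaussianReal 0 1 := by
  rw [nullMeasure, integral_fintype_prod_eq_prod (fun u (y : Fin p → ℝ) => ∏ v, y v ^ m u v)]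
  exact Finset.prod_congr rfl fun u _ => integral_fintype_prod_eq_prod (fun v (y : ℝ) => y ^ m u v)

lemma integrable_prod_pow_nullMeasure (m : Fin n → Fin p → ℕ) :
    Integrable (fun x => ∏ u, ∏ v, x u v ^ m u v) (nullMeasure n p) :=
  Integrable.fintype_prod (f := fun u (y : Fin p → ℝ) => ∏ v, y v ^ m u v) fun u =>
    Integrable.fintype_prod (f := fun v (y : ℝ) => y ^ m u v) fun _ => integrable_pow_gaussianReal _

lemma prod_cells_eq (E : Finset (Fin n × Fin p)) (x : DataMat n p) :
    ∏ e ∈ E, x e.1 e.2 = ∏ u, ∏ v, x u v ^ (if (u, v) ∈ E then 1 else 0) := by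
  simp_rw [pow_ite, pow_one, pow_zero]
  rw [← Finset.prod_product' Finset.univ Finset.univ
    (fun u v => if (u, v) ∈ E then x u v else 1), Finset.univ_product_univ, Finset.prod_ite_mem,
    Finset.univ_inter]

lemma prod_cells_mul_eq (E F : Finset (Fin n × Fin p)) (x : DataMat n p) :
    (∏ e ∈ E, x e.1 e.2) * ∏ e ∈ F, x e.1 e.2 = ∏ u, ∏ v,
      x u v ^ ((if (u, v) ∈ E then 1 else 0) + (if (u, v) ∈ F then 1 else 0)) := by
  simp only [prod_cells_eq, pow_add, Finset.prod_mul_distrib]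

lemma integral_prod_cells_mul (E F : Finset (Fin n × Fin p)) :
    ∫ x, (∏ e ∈ E, x e.1 e.2) * ∏ e ∈ F, x e.1 e.2 ∂nullMeasure n p = if E = F then 1 else 0 := by
  simp_rw [prod_cells_mul_eq]
  rw [integral_prod_pow_nullMeasure]
  split_ifs with h
  · subst h
    refine Finset.prod_eq_one fun u _ => Finset.prod_eq_one fun v _ => ?_
    split_ifs
    · exact integral_sq_gaussianReal
    · simp
  · obtain ⟨⟨u, v⟩, huv⟩ : ∃ e, ¬(e ∈ E ↔ e ∈ F) := by
      by_contra! H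
      exact h (Finset.ext H)
    refine Finset.prod_eq_zero (Finset.mem_univ u) (Finset.prod_eq_zero (Finset.mem_univ v) ?_)
    have : (if (u, v) ∈ E then 1 else 0) + (if (u, v) ∈ F then 1 else 0) = 1 := by
      split_ifs <;> simp_all
    rw [this]
    simp

lemma integrable_prod_cells_mul (E F : Finset (Fin n × Fin p)) :
    Integrable (fun x => (∏ e ∈ E, x e.1 e.2) * ∏ e ∈ F, x e.1 e.2) (nullMeasure n p) := by
  simp_rw [prod_cells_mul_eq]
  exact integrable_prod_pow_nullMeasure _

lemma variance_cycleStat_one :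
    Var[fun x => cycleStat x 1; nullMeasure n p] = 2 * ((p : ℝ) / n) * ((n : ℝ) / n) := by
  have hB : (fun x : DataMat n p => cycleStat x 1) =
      fun x => 1 / (n : ℝ) *
        (∑ u, fun x : DataMat n p => (∑ v, fun y : Fin p → ℝ => y v ^ 2) (x u)) x := by
    funext x
    rw [cycleStat, ← (Equiv.funUnique (Fin 1) (Fin n)).symm.sum_comp]
    simp_rw [← (Equiv.funUnique (Fin 1) (Fin p)).symm.sum_comp]
    simp [Function.injective_of_subsingleton, sq]
  rw [hB, variance_const_mul, nullMeasure,
    variance_sum_pi (X := fun _ => ∑ v, fun y : Fin p → ℝ => y v ^ 2)]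
  · simp_rw [variance_sum_pi (μ := fun _ : Fin p => gaussianReal 0 1) (X := fun _ y => y ^ 2)
      (fun _ => memLp_sq_gaussianReal), variance_sq_gaussianReal]
    simp
    ring
  · intro u
    refine memLp_finsetSum' _ fun v _ => ?_
    exact memLp_sq_gaussianReal.comp_measurePreserving
      (measurePreserving_eval (fun _ : Fin p => gaussianReal 0 1) v)

lemma variance_cycleStat_add_two (k : ℕ) :
    Var[fun x => cycleStat x (k + 2); nullMeasure n p] =
      2 * (k + 2 : ℕ) * (n.descFactorial (k + 2) / (n : ℝ) ^ (k + 2)) *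
        (p.descFactorial (k + 2) / (n : ℝ) ^ (k + 2)) := by
  simp only [cycleStat_eq_sum_prod]
  rw [variance_const_mul, variance_of_integral_eq_zero]
  · simp_rw [sq (Finset.sum _ _), Finset.sum_mul_sum]
    rw [integral_finsetSum _ fun q _ => integrable_finsetSum _ fun q' _ =>
      integrable_prod_cells_mul _ _]
    simp_rw [integral_finsetSum _ fun q' _ => integrable_prod_cells_mul _ _,
      integral_prod_cells_mul, ← Finset.sum_filter]
    rw [Finset.sum_congr rfl fun q hq => (by
      rw [Finset.sum_const, card_filter_cycleCells_eq hq])]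
    rw [Finset.sum_const, card_cycleLabels]
    simp
    ring
  · exact (Finset.measurable_sum _ fun q _ => Finset.measurable_prod _ fun e _ => by
      fun_prop).aemeasurable
  · rw [integral_finsetSum]
    · refine Finset.sum_eq_zero fun q _ => ?_
      have := integral_prod_cells_mul (cycleCells q) ∅
      simpa [(cycleCells_nonempty q).ne_empty] using this
    · intro q _
      simpa using integrable_prod_cells_mul (cycleCells q) ∅

end Moments

lemma tendsto_descFactorial_div_pow {c : ℝ} {a : ℕ → ℕ}
    (ha : Tendsto (fun n => (a n : ℝ) / n) atTop (𝓝 c)) (k : ℕ) :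
    Tendsto (fun n => ((a n).descFactorial k : ℝ) / (n : ℝ) ^ k) atTop (𝓝 (c ^ k)) := by
  induction k with
  | zero => simp
  | succ k ih =>
    have h : Tendsto (fun n => ((a n - k : ℕ) : ℝ) / n) atTop (𝓝 c) := by
      have hk : Tendsto (fun n : ℕ => (k : ℝ) / n) atTop (𝓝 0) :=
        tendsto_const_div_atTop_nhds_zero_nat _
      refine tendsto_of_tendsto_of_tendsto_of_le_of_le (by simpa using ha.sub hk) ha
        (fun n => ?_) (fun n => ?_)
      · simp only [← sub_div]
        gcongr
        exact sub_le_iff_le_add.2 (mod_cast le_tsub_add)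
      · simp only
        gcongr
        exact tsub_le_self
    rw [pow_succ']
    refine (h.mul ih).congr fun n => ?_
    rw [Nat.descFactorial_succ]
    push_cast
    rw [div_mul_div_comm, pow_succ']

theorem cycle_variance_null
    (γ : ℝ) (hγ : 0 < γ) (p : ℕ → ℕ)
    (hp : Tendsto (fun n => (p n : ℝ) / (n : ℝ)) atTop (𝓝 γ)) :
    -- `Var(B_{n,1}) → 2γ`:
    Tendsto (fun n => variance (fun x => cycleStat x 1) (nullMeasure n (p n)))
      atTop (𝓝 (2 * γ)) ∧
    -- for each fixed `k ≥ 2`, `Var(B_{n,k}) = (1 + o(1)) · 2kγ^k`: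
    ∀ k : ℕ, 2 ≤ k →
      Tendsto (fun n => variance (fun x => cycleStat x k) (nullMeasure n (p n)))
        atTop (𝓝 (2 * k * γ ^ k)) := by
  have hn : Tendsto (fun n : ℕ => (n : ℝ) / n) atTop (𝓝 1) :=
    tendsto_const_nhds.congr' <| (eventually_ne_atTop 0).mono fun n hn =>
      (div_self (Nat.cast_ne_zero.2 hn)).symm
  refine ⟨?_, fun k hk => ?_⟩
  · simp_rw [variance_cycleStat_one]
    simpa using (hp.const_mul 2).mul hn
  · obtain ⟨k, rfl⟩ := Nat.exists_eq_add_of_le' hk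
    simp_rw [variance_cycleStat_add_two]
    simpa using ((tendsto_descFactorial_div_pow hn (k + 2)).const_mul
      (2 * ((k + 2 : ℕ) : ℝ))).mul (tendsto_descFactorial_div_pow hp (k + 2))
end
end

section
/- (Exact orthogonality of bipartite signed cycles of different lengths under the null.) Let X ∈ ℝ^{n×p} have entries X_{ij} i.i.d. N(0,1). Then for all integers 1 ≤ k₁ < k₂ ≤ n∧p, E[(B_{n,k₁} − p·1{k₁=1}) · B_{n,k₂}] = 0. -/
/- Statement 14: exact orthogonality of bipartite signed cycles of different
lengths under the null. -/

open MeasureTheory ProbabilityTheory Filter Topology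

noncomputable section

/-- The monomial `X_{i₀j₀} X_{i₁j₀} ⋯ X_{i_{k-1}j_{k-1}} X_{i₀j_{k-1}}` of a closed walk. -/
def cycleMonomial {n p k : ℕ} (i : Fin k → Fin n) (j : Fin k → Fin p) (X : DataMat n p) : ℝ :=
  ∏ a : Fin k, X (i a) (j a) * X (i ⟨((a : ℕ) + 1) % k, Nat.mod_lt _ a.pos⟩) (j a)

/-- The edges traversed by a closed walk in the complete bipartite graph. -/
def cycleEdge {n p k : ℕ} (i : Fin k → Fin n) (j : Fin k → Fin p) :
    Fin k ⊕ Fin k → Fin n × Fin p :=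
  Sum.elim (fun a => (i a, j a))
    (fun a => (i ⟨((a : ℕ) + 1) % k, Nat.mod_lt _ a.pos⟩, j a))

/-- Entrywise change of signs of a data array. -/
def signChange {n p : ℕ} (s : Fin n × Fin p → ℤˣ) (X : DataMat n p) : DataMat n p :=
  fun i j => ((s (i, j) : ℤ) : ℝ) * X i j

lemma signChange_mul {n p : ℕ} (s t : Fin n × Fin p → ℤˣ) (X : DataMat n p) :
    signChange (s * t) X = signChange s (signChange t X) := by
  ext i j
  simp [signChange, mul_assoc]

lemma cycleMonomial_eq_prod_cycleEdge {n p k : ℕ} (i : Fin k → Fin n) (j : Fin k → Fin p)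
    (X : DataMat n p) :
    cycleMonomial i j X = ∏ t, X (cycleEdge i j t).1 (cycleEdge i j t).2 := by
  simp [cycleMonomial, cycleEdge, Fintype.prod_sum_type, Finset.prod_mul_distrib]

lemma cycleEdge_injective {n p k : ℕ} (hk : 2 ≤ k) {i : Fin k → Fin n} {j : Fin k → Fin p}
    (hi : Function.Injective i) (hj : Function.Injective j) :
    Function.Injective (cycleEdge i j) := by
  have hsucc : ∀ a : Fin k, (⟨((a : ℕ) + 1) % k, Nat.mod_lt _ a.pos⟩ : Fin k) ≠ a := by
    intro a h
    have h' : ((a : ℕ) + 1) % k = a := congrArg Fin.val h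
    have ha := a.isLt
    rcases Nat.lt_or_ge ((a : ℕ) + 1) k with hlt | hge
    · rw [Nat.mod_eq_of_lt hlt] at h'
      omega
    · have hak : (a : ℕ) + 1 = k := by omega
      rw [hak, Nat.mod_self] at h'
      omega
  rintro (a | a) (b | b) h <;> simp only [cycleEdge, Sum.elim_inl, Sum.elim_inr, Prod.mk.injEq] at h
  · rw [hj h.2]
  · obtain rfl := hj h.2
    exact absurd (hi h.1).symm (hsucc a)
  · obtain rfl := hj h.2
    exact absurd (hi h.1) (hsucc a)
  · rw [hj h.2]

lemma exists_cycleEdge_notMem_range {n p k₁ k₂ : ℕ} (hk : k₁ < k₂) (hk₂ : 2 ≤ k₂)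
    (i₁ : Fin k₁ → Fin n) (j₁ : Fin k₁ → Fin p) {i₂ : Fin k₂ → Fin n} {j₂ : Fin k₂ → Fin p}
    (hi : Function.Injective i₂) (hj : Function.Injective j₂) :
    ∃ t, ∀ u, cycleEdge i₁ j₁ u ≠ cycleEdge i₂ j₂ t := by
  by_contra! h
  choose f hf using h
  have hinj : Function.Injective f := fun a b hab =>
    cycleEdge_injective hk₂ hi hj (by rw [← hf a, ← hf b, hab])
  have := Fintype.card_le_of_injective f hinj
  simp only [Fintype.card_sum, Fintype.card_fin] at this
  omega

lemma cycleMonomial_signChange {n p k : ℕ} (i : Fin k → Fin n) (j : Fin k → Fin p)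
    (s : Fin n × Fin p → ℤˣ) (X : DataMat n p) :
    cycleMonomial i j (signChange s X)
      = (∏ t, ((s (cycleEdge i j t) : ℤ) : ℝ)) * cycleMonomial i j X := by
  simp [cycleMonomial_eq_prod_cycleEdge, signChange, Finset.prod_mul_distrib]

/-- Changing the sign of an entry outside the cycle leaves its monomial unchanged. -/
lemma cycleMonomial_flip_of_notMem {n p k : ℕ} (i : Fin k → Fin n) (j : Fin k → Fin p)
    {e : Fin n × Fin p} (he : ∀ u, cycleEdge i j u ≠ e) (X : DataMat n p) :
    cycleMonomial i j (signChange (Pi.mulSingle e (-1)) X) = cycleMonomial i j X := by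
  rw [cycleMonomial_signChange, Finset.prod_eq_one, one_mul]
  intro u _
  simp [Pi.mulSingle_eq_of_ne (he u)]

/-- Changing the sign of an entry of the cycle changes the sign of its monomial. -/
lemma cycleMonomial_flip_of_mem {n p k : ℕ} (hk : 2 ≤ k) {i : Fin k → Fin n} {j : Fin k → Fin p}
    (hi : Function.Injective i) (hj : Function.Injective j) (t : Fin k ⊕ Fin k)
    (X : DataMat n p) :
    cycleMonomial i j (signChange (Pi.mulSingle (cycleEdge i j t) (-1)) X)
      = -cycleMonomial i j X := by
  rw [cycleMonomial_signChange, Finset.prod_eq_single t]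
  · simp
  · intro u _ hu
    simp [Pi.mulSingle_eq_of_ne ((cycleEdge_injective hk hi hj).ne hu)]
  · simp

/-- A function that is odd under some sign change averages to zero over all sign changes. -/
lemma sum_signChange_eq_zero_of_odd {n p : ℕ} {f : DataMat n p → ℝ} (t : Fin n × Fin p → ℤˣ)
    (hf : ∀ X, f (signChange t X) = -f X) (X : DataMat n p) :
    ∑ s, f (signChange s X) = 0 := by
  have h := Equiv.sum_comp (Equiv.mulLeft t) fun s => f (signChange s X)
  simp only [Equiv.coe_mulLeft, signChange_mul, hf, Finset.sum_neg_distrib] at h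
  linarith

lemma sum_mul_cycleStat_eq_zero {n p k : ℕ} {ι : Type*} (s : Finset ι) (g : ι → ℝ)
    (Y : ι → DataMat n p)
    (h : ∀ (i : Fin k → Fin n) (j : Fin k → Fin p), Function.Injective i → Function.Injective j →
      ∑ a ∈ s, g a * cycleMonomial i j (Y a) = 0) :
    ∑ a ∈ s, g a * cycleStat (Y a) k = 0 := by
  have hrw : ∀ a, g a * cycleStat (Y a) k = 1 / (n : ℝ) ^ k *
      ∑ i : Fin k → Fin n, ∑ j : Fin k → Fin p,
        if Function.Injective i ∧ Function.Injective j then g a * cycleMonomial i j (Y a)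
        else 0 := by
    intro a
    simp only [cycleStat, cycleMonomial]
    rw [mul_left_comm]
    simp only [Finset.mul_sum, mul_ite, mul_zero]
  simp only [hrw]
  rw [← Finset.mul_sum, Finset.sum_comm]
  refine mul_eq_zero_of_right _ (Finset.sum_eq_zero fun i _ => ?_)
  rw [Finset.sum_comm]
  refine Finset.sum_eq_zero fun j _ => ?_
  split_ifs with hij
  · exact h i j hij.1 hij.2
  · simp

lemma measurePreserving_signChange {n p : ℕ} (s : Fin n × Fin p → ℤˣ) :
    MeasurePreserving (signChange s) (nullMeasure n p) (nullMeasure n p) := by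
  refine measurePreserving_pi _ _ fun i => measurePreserving_pi _ _ fun j => ⟨by fun_prop, ?_⟩
  rw [gaussianReal_map_const_mul]
  rcases Int.units_eq_one_or (s (i, j)) with h | h <;> simp [h]

/-- A function averaging to zero over all sign changes has mean zero under the null. -/
lemma integral_nullMeasure_eq_zero {n p : ℕ} {f : DataMat n p → ℝ}
    (hf : ∀ X, ∑ s, f (signChange s X) = 0) : ∫ X, f X ∂nullMeasure n p = 0 := by
  by_cases hint : Integrable f (nullMeasure n p)
  · have hcomp : ∀ s, ∫ X, f (signChange s X) ∂nullMeasure n p = ∫ X, f X ∂nullMeasure n p := by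
      intro s
      have hs := measurePreserving_signChange s
      have hm : AEStronglyMeasurable f ((nullMeasure n p).map (signChange s)) := by
        rw [hs.map_eq]
        exact hint.aestronglyMeasurable
      rw [← integral_map hs.measurable.aemeasurable hm, hs.map_eq]
    have hsum := integral_finsetSum (μ := nullMeasure n p) Finset.univ
      (f := fun s X => f (signChange s X))
      fun s _ => (measurePreserving_signChange s).integrable_comp_of_integrable hint
    simp only [hf, hcomp, integral_zero, Finset.sum_const, nsmul_eq_mul] at hsum
    refine (mul_eq_zero.mp hsum.symm).resolve_left ?_
    simp
  · exact integral_undef hint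

theorem cycle_orthogonality_null
    (n p : ℕ) (k₁ k₂ : ℕ) (hk₁ : 1 ≤ k₁) (hk : k₁ < k₂) (hk₂ : k₂ ≤ min n p) :
    ∫ x, (cycleStat x k₁ - if k₁ = 1 then (p : ℝ) else 0) * cycleStat x k₂
      ∂nullMeasure n p = 0 := by
  have h2 : 2 ≤ k₂ := by omega
  refine integral_nullMeasure_eq_zero fun X => ?_
  refine sum_mul_cycleStat_eq_zero _ _ _ fun i₂ j₂ hi hj => ?_
  simp only [sub_mul, Finset.sum_sub_distrib, ← Finset.mul_sum]
  rw [sum_signChange_eq_zero_of_odd (f := cycleMonomial i₂ j₂) _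
    (cycleMonomial_flip_of_mem h2 hi hj (Sum.inl ⟨0, by omega⟩)), mul_zero, sub_zero]
  simp only [mul_comm (cycleStat _ k₁)]
  refine sum_mul_cycleStat_eq_zero _ _ _ fun i₁ j₁ _ _ => ?_
  obtain ⟨t, ht⟩ := exists_cycleEdge_notMem_range hk h2 i₁ j₁ hi hj
  refine sum_signChange_eq_zero_of_odd
    (f := fun Y => cycleMonomial i₂ j₂ Y * cycleMonomial i₁ j₁ Y)
    (Pi.mulSingle (cycleEdge i₂ j₂ t) (-1)) (fun Y => ?_) X
  rw [cycleMonomial_flip_of_mem h2 hi hj t, cycleMonomial_flip_of_notMem i₁ j₁ ht, neg_mul]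
end
end
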